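/- arXiv:1901.06534 — 2 statements merged into one kernel-verified Lean document; each statement's English description precedes it below -/
import Mathlib

section
/- For every directed acyclic graph D on an even number n of vertices, the directed intersection number of D is at most 5n²/8 − 3n/4 + 1. -/
/-- `φ` is a directed intersection representation of the digraph with arc relation `A`. -/
def IsDIRep {V : Type*} (A : V → V → Prop) (φ : V → Finset ℕ) : Prop :=
  (∀ v, (φ v).Nonempty) ∧
  ∀ u v, A u v ↔ ((φ u ∩ φ v).Nonempty ∧ (φ u).card < (φ v).card)

/-- The digraph contains a directed cycle. -/
def HasDirCycle {V : Type*} (A : V → V → Prop) : Prop :=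
  ∃ (k : ℕ) (c : ℕ → V), 1 ≤ k ∧ c k = c 0 ∧ ∀ i < k, A (c i) (c (i + 1))

/-- `φ` represents the subgraph induced on `S`. -/
def RepOn {V : Type*} (A : V → V → Prop) (S : Finset V) (φ : V → Finset ℕ) : Prop :=
  (∀ v ∈ S, (φ v).Nonempty) ∧
  ∀ u ∈ S, ∀ v ∈ S, A u v ↔ ((φ u ∩ φ v).Nonempty ∧ (φ u).card < (φ v).card)

/-- The inductive state: a cheap representation, whose sets are either small or
where some sink has a private color. -/
def GoodOn {V : Type*} (A : V → V → Prop) (S : Finset V) (m : ℕ) : Prop :=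
  ∃ φ : V → Finset ℕ, RepOn A S φ ∧ 2 * (S.biUnion φ).card + 3 * m ≤ 5 * m ^ 2 + 2 ∧
    (∀ v ∈ S, (φ v).card + 1 ≤ 3 * m) ∧
    ((∀ v ∈ S, (φ v).card + 2 ≤ 3 * m) ∨
      ∃ u ∈ S, ∃ v ∈ S, ∃ p, A u v ∧ (∀ w ∈ S, ¬ A v w) ∧ p ∈ φ v ∧ ∀ w ∈ S, w ≠ v → p ∉ φ w)

lemma exists_sink {n : ℕ} {A : Fin n → Fin n → Prop} (h : ¬ HasDirCycle A)
    (S : Finset (Fin n)) (hS : S.Nonempty) : ∃ v ∈ S, ∀ w ∈ S, ¬ A v w := by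
  by_contra hcon
  push Not at hcon
  obtain ⟨v0, hv0⟩ := hS
  choose! f hf hA using hcon
  let g : ℕ → Fin n := fun k => f^[k] v0
  have hgS : ∀ k, g k ∈ S := by
    intro k
    induction k with
    | zero => exact hv0
    | succ k ih =>
      show f^[k+1] v0 ∈ S
      rw [Function.iterate_succ_apply']
      exact hf _ ih
  have hgA : ∀ k, A (g k) (g (k+1)) := by
    intro k
    show A (f^[k] v0) (f^[k+1] v0)
    rw [Function.iterate_succ_apply']
    exact hA _ (hgS k)
  obtain ⟨a, b, hab, heq⟩ := Finite.exists_ne_map_eq_of_infinite g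
  rcases lt_or_gt_of_ne hab with hlt | hlt
  · exact h ⟨b - a, fun i => g (a + i), by omega, by
      show g (a + (b - a)) = g (a + 0)
      rw [Nat.add_sub_cancel' hlt.le]; exact heq.symm, fun i _ => hgA (a + i)⟩
  · exact h ⟨a - b, fun i => g (b + i), by omega, by
      show g (b + (a - b)) = g (b + 0)
      rw [Nat.add_sub_cancel' hlt.le]; exact heq, fun i _ => hgA (b + i)⟩

lemma no_loop {n : ℕ} {A : Fin n → Fin n → Prop} (h : ¬ HasDirCycle A) (v : Fin n) :
    ¬ A v v := fun hv => h ⟨1, fun _ => v, le_refl _, rfl, fun _ _ => hv⟩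

lemma exists_bound {V : Type*} (S : Finset V) (φ : V → Finset ℕ) :
    ∃ N, ∀ w ∈ S, ∀ x ∈ φ w, x < N := by
  classical
  refine ⟨(S.biUnion φ).sup id + 1, fun w hw x hx => ?_⟩
  have : id x ≤ (S.biUnion φ).sup id :=
    Finset.le_sup (f := id) (Finset.mem_biUnion.2 ⟨w, hw, hx⟩)
  simp only [id] at this
  omega

/-- Increment every set. -/
lemma incr {V : Type*} {A : V → V → Prop} {S : Finset V} {φ : V → Finset ℕ}
    (h : RepOn A S φ) (c : V → ℕ) (hc : ∀ w ∈ S, c w ∉ φ w)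
    (hcc : ∀ w ∈ S, ∀ x ∈ S, w ≠ x → c w ∈ insert (c x) (φ x) → A w x ∨ A x w) :
    RepOn A S (fun w => insert (c w) (φ w)) := by
  refine ⟨fun v hv => Finset.insert_nonempty _ _, fun u hu v hv => ?_⟩
  simp only [Finset.card_insert_of_notMem (hc u hu), Finset.card_insert_of_notMem (hc v hv)]
  constructor
  · intro ha
    obtain ⟨⟨x, hx⟩, hlt⟩ := (h.2 u hu v hv).1 ha
    rw [Finset.mem_inter] at hx
    exact ⟨⟨x, by simp [hx.1, hx.2]⟩, by omega⟩
  · rintro ⟨⟨x, hx⟩, hlt⟩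
    have hne : u ≠ v := by rintro rfl; omega
    have key : A u v ∨ A v u → A u v := by
      rintro (h1 | h1)
      · exact h1
      · have := ((h.2 v hv u hu).1 h1).2
        omega
    rw [Finset.mem_inter] at hx
    obtain ⟨h1, h2⟩ := hx
    rcases Finset.mem_insert.1 h1 with rfl | h1
    · exact key (hcc u hu v hv hne h2)
    · rcases Finset.mem_insert.1 h2 with rfl | h2'
      · exact key ((hcc v hv u hu hne.symm (Finset.mem_insert_of_mem h1)).symm)
      · exact (h.2 u hu v hv).2 ⟨⟨x, Finset.mem_inter.2 ⟨h1, h2'⟩⟩, by omega⟩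

/-- Add an adjacent pair on top. -/
lemma ext_adj {V : Type*} [DecidableEq V] {A : V → V → Prop} {S : Finset V} {φ : V → Finset ℕ}
    (h : RepOn A S φ) {u v : V} (huv : u ≠ v) (huS : u ∉ S) (hvS : v ∉ S) (s q : ℕ)
    (hs : ∀ w ∈ S, (φ w).card < s) (Cu Cv : Finset ℕ)
    (hCu : Cu ⊆ S.biUnion φ) (hCv : Cv ⊆ S.biUnion φ)
    (hu : ∀ w ∈ S, (φ w ∩ Cu).Nonempty ↔ A w u) (hv : ∀ w ∈ S, (φ w ∩ Cv).Nonempty ↔ A w v)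
    (hus : Cu.card < s) (hvs : Cv.card < s) (ha : A u v) (hau : ∀ w ∈ S, ¬ A u w)
    (hav : ∀ w ∈ S, ¬ A v w) (hvu : ¬ A v u) (huu : ¬ A u u) (hvv : ¬ A v v)
    (hqu : s ≤ q + Cu.card) (hqv : s ≤ q + Cv.card) :
    ∃ ψ : V → Finset ℕ, RepOn A (insert u (insert v S)) ψ ∧
      ((insert u (insert v S)).biUnion ψ).card ≤ (S.biUnion φ).card + 1 + q ∧
      (∀ w ∈ insert u (insert v S), (ψ w).card ≤ s + 1) ∧
      ∃ p ∈ ψ v, ∀ w ∈ insert u (insert v S), w ≠ v → p ∉ ψ w := by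
  obtain ⟨N, hN⟩ := exists_bound S φ
  have hNu : ∀ x ∈ Cu, x < N := fun x hx => by
    obtain ⟨w, hw, hx⟩ := Finset.mem_biUnion.1 (hCu hx)
    exact hN w hw x hx
  have hNv : ∀ x ∈ Cv, x < N := fun x hx => by
    obtain ⟨w, hw, hx⟩ := Finset.mem_biUnion.1 (hCv hx)
    exact hN w hw x hx
  set Pu := Cu ∪ Finset.Ico (N+1) (N+1+(s - Cu.card)) with hPu
  set Pv := Cv ∪ insert N (Finset.Ico (N+1) (N+1+(s - Cv.card))) with hPv
  have cu : Pu.card = s := by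
    rw [hPu, Finset.card_union_of_disjoint, Nat.card_Ico]
    · omega
    · rw [Finset.disjoint_left]
      intro x hx hx'
      have := hNu x hx
      rw [Finset.mem_Ico] at hx'
      omega
  have cv : Pv.card = s + 1 := by
    rw [hPv, Finset.card_union_of_disjoint, Finset.card_insert_of_notMem, Nat.card_Ico]
    · omega
    · simp
    · rw [Finset.disjoint_left]
      intro x hx hx'
      have := hNv x hx
      rw [Finset.mem_insert, Finset.mem_Ico] at hx'
      omega
  have iu : ∀ w ∈ S, (φ w ∩ Pu).Nonempty ↔ A w u := by
    intro w hw
    rw [← hu w hw]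
    have : φ w ∩ Pu = φ w ∩ Cu := by
      ext x
      simp only [hPu, Finset.mem_inter, Finset.mem_union, Finset.mem_Ico]
      have := hN w hw x
      constructor
      · rintro ⟨h1, h2 | h2⟩
        · exact ⟨h1, h2⟩
        · have := this h1; omega
      · rintro ⟨h1, h2⟩; exact ⟨h1, Or.inl h2⟩
    rw [this]
  have iv : ∀ w ∈ S, (φ w ∩ Pv).Nonempty ↔ A w v := by
    intro w hw
    rw [← hv w hw]
    have : φ w ∩ Pv = φ w ∩ Cv := by
      ext x
      simp only [hPv, Finset.mem_inter, Finset.mem_union, Finset.mem_Ico, Finset.mem_insert]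
      have := hN w hw x
      constructor
      · rintro ⟨h1, h2 | h2⟩
        · exact ⟨h1, h2⟩
        · have := this h1; omega
      · rintro ⟨h1, h2⟩; exact ⟨h1, Or.inl h2⟩
    rw [this]
  have iuv : (Pu ∩ Pv).Nonempty := by
    refine ⟨N+1, ?_⟩
    simp only [hPu, hPv, Finset.mem_inter, Finset.mem_union, Finset.mem_Ico, Finset.mem_insert]
    constructor <;> right
    · omega
    · right; omega
  let ψ : V → Finset ℕ := fun x => if x = v then Pv else if x = u then Pu else φ x
  have ψv : ψ v = Pv := by simp [ψ]
  have ψu : ψ u = Pu := by simp [ψ, huv]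
  have ψw : ∀ w ∈ S, ψ w = φ w := by
    intro w hw
    have h1 : w ≠ v := by rintro rfl; exact hvS hw
    have h2 : w ≠ u := by rintro rfl; exact huS hw
    simp [ψ, h1, h2]
  refine ⟨ψ, ⟨?_, ?_⟩, ?_, ?_, N, ?_, ?_⟩
  · intro w hw
    simp only [Finset.mem_insert] at hw
    rcases hw with rfl | rfl | hw
    · rw [ψu]; exact iuv.mono Finset.inter_subset_left
    · rw [ψv]; exact iuv.mono Finset.inter_subset_right
    · rw [ψw w hw]; exact h.1 w hw
  · intro x hx y hy
    simp only [Finset.mem_insert] at hx hy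
    rcases hx with rfl | rfl | hx <;> rcases hy with rfl | rfl | hy
    · simp [huu]
    · rw [ψu, ψv]; simp [ha, iuv, cu, cv]
    · rw [ψu, ψw y hy]; have := hs y hy; simp [hau y hy, cu]; omega
    · rw [ψu, ψv]; simp [hvu, cu, cv]
    · simp [hvv]
    · rw [ψv, ψw y hy]; have := hs y hy; simp [hav y hy, cv]; omega
    · rw [ψu, ψw x hx, iu x hx, cu]; simp [hs x hx]
    · rw [ψv, ψw x hx, iv x hx, cv]; have := hs x hx; simp; omega
    · rw [ψw x hx, ψw y hy]; exact h.2 x hx y hy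
  · have : (insert u (insert v S)).biUnion ψ ⊆ S.biUnion φ ∪ Finset.Ico N (N+1+q) := by
      intro x hx
      obtain ⟨w, hw, hx⟩ := Finset.mem_biUnion.1 hx
      simp only [Finset.mem_insert] at hw
      rw [Finset.mem_union, Finset.mem_Ico]
      rcases hw with rfl | rfl | hw
      · rw [ψu, hPu, Finset.mem_union, Finset.mem_Ico] at hx
        rcases hx with hx | hx
        · exact Or.inl (hCu hx)
        · right; omega
      · rw [ψv, hPv, Finset.mem_union, Finset.mem_insert, Finset.mem_Ico] at hx
        rcases hx with hx | hx
        · exact Or.inl (hCv hx)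
        · right; omega
      · rw [ψw w hw] at hx
        exact Or.inl (Finset.mem_biUnion.2 ⟨w, hw, hx⟩)
    refine (Finset.card_le_card this).trans ((Finset.card_union_le _ _).trans ?_)
    rw [Nat.card_Ico]; omega
  · intro w hw
    simp only [Finset.mem_insert] at hw
    rcases hw with rfl | rfl | hw
    · rw [ψu, cu]; omega
    · rw [ψv, cv]
    · rw [ψw w hw]; have := hs w hw; omega
  · rw [ψv, hPv]; simp
  · intro w hw hwv hx
    simp only [Finset.mem_insert] at hw
    rcases hw with rfl | rfl | hw
    · rw [ψu, hPu, Finset.mem_union, Finset.mem_Ico] at hx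
      rcases hx with hx | hx
      · exact lt_irrefl _ (hNu _ hx)
      · omega
    · exact hwv rfl
    · rw [ψw w hw] at hx
      exact lt_irrefl _ (hN w hw _ hx)

/-- Add a nonadjacent pair on top. -/
lemma ext_non {V : Type*} [DecidableEq V] {A : V → V → Prop} {S : Finset V} {φ : V → Finset ℕ}
    (h : RepOn A S φ) {u v : V} (huv : u ≠ v) (huS : u ∉ S) (hvS : v ∉ S) (s : ℕ)
    (hs : ∀ w ∈ S, (φ w).card < s) (Cu Cv : Finset ℕ)
    (hCu : Cu ⊆ S.biUnion φ) (hCv : Cv ⊆ S.biUnion φ)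
    (hu : ∀ w ∈ S, (φ w ∩ Cu).Nonempty ↔ A w u) (hv : ∀ w ∈ S, (φ w ∩ Cv).Nonempty ↔ A w v)
    (hus : Cu.card < s) (hvs : Cv.card < s) (ha : ¬ A u v) (hau : ∀ w ∈ S, ¬ A u w)
    (hav : ∀ w ∈ S, ¬ A v w) (hvu : ¬ A v u) (huu : ¬ A u u) (hvv : ¬ A v v) :
    ∃ ψ : V → Finset ℕ, RepOn A (insert u (insert v S)) ψ ∧
      ((insert u (insert v S)).biUnion ψ).card ≤ (S.biUnion φ).card + s ∧
      (∀ w ∈ insert u (insert v S), (ψ w).card ≤ s) := by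
  obtain ⟨N, hN⟩ := exists_bound S φ
  have main : ∀ C : Finset ℕ, C ⊆ S.biUnion φ → C.card < s → ∃ P : Finset ℕ,
      P.card = s ∧ (∀ w ∈ S, φ w ∩ P = φ w ∩ C) ∧ P ⊆ S.biUnion φ ∪ Finset.Ico N (N + s) := by
    intro C hC hCs
    have hNu : ∀ x ∈ C, x < N := fun x hx => by
      obtain ⟨w, hw, hx⟩ := Finset.mem_biUnion.1 (hC hx)
      exact hN w hw x hx
    refine ⟨C ∪ Finset.Ico N (N+(s - C.card)), ?_, ?_, ?_⟩
    · rw [Finset.card_union_of_disjoint, Nat.card_Ico]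
      · omega
      · rw [Finset.disjoint_left]
        intro x hx hx'
        have := hNu x hx
        rw [Finset.mem_Ico] at hx'
        omega
    · intro w hw
      ext x
      simp only [Finset.mem_inter, Finset.mem_union, Finset.mem_Ico]
      have := hN w hw x
      constructor
      · rintro ⟨h1, h2 | h2⟩
        · exact ⟨h1, h2⟩
        · have := this h1; omega
      · rintro ⟨h1, h2⟩; exact ⟨h1, Or.inl h2⟩
    · exact Finset.union_subset_union hC (Finset.Ico_subset_Ico_right (by omega))
  obtain ⟨Pu, cu, iu', su⟩ := main Cu hCu hus
  obtain ⟨Pv, cv, iv', sv⟩ := main Cv hCv hvs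
  have iu : ∀ w ∈ S, (φ w ∩ Pu).Nonempty ↔ A w u := fun w hw => by rw [iu' w hw, hu w hw]
  have iv : ∀ w ∈ S, (φ w ∩ Pv).Nonempty ↔ A w v := fun w hw => by rw [iv' w hw, hv w hw]
  let ψ : V → Finset ℕ := fun x => if x = v then Pv else if x = u then Pu else φ x
  have ψv : ψ v = Pv := by simp [ψ]
  have ψu : ψ u = Pu := by simp [ψ, huv]
  have ψw : ∀ w ∈ S, ψ w = φ w := by
    intro w hw
    have h1 : w ≠ v := by rintro rfl; exact hvS hw
    have h2 : w ≠ u := by rintro rfl; exact huS hw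
    simp [ψ, h1, h2]
  refine ⟨ψ, ⟨?_, ?_⟩, ?_, ?_⟩
  · intro w hw
    simp only [Finset.mem_insert] at hw
    rcases hw with rfl | rfl | hw
    · rw [ψu]; apply Finset.card_pos.1; omega
    · rw [ψv]; apply Finset.card_pos.1; omega
    · rw [ψw w hw]; exact h.1 w hw
  · intro x hx y hy
    simp only [Finset.mem_insert] at hx hy
    rcases hx with rfl | rfl | hx <;> rcases hy with rfl | rfl | hy
    · simp [huu]
    · rw [ψu, ψv]; simp [ha, cu, cv]
    · rw [ψu, ψw y hy]; have := hs y hy; simp [hau y hy, cu]; omega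
    · rw [ψu, ψv]; simp [hvu, cu, cv]
    · simp [hvv]
    · rw [ψv, ψw y hy]; have := hs y hy; simp [hav y hy, cv]; omega
    · rw [ψu, ψw x hx, iu x hx, cu]; simp [hs x hx]
    · rw [ψv, ψw x hx, iv x hx, cv]; simp [hs x hx]
    · rw [ψw x hx, ψw y hy]; exact h.2 x hx y hy
  · have : (insert u (insert v S)).biUnion ψ ⊆ S.biUnion φ ∪ Finset.Ico N (N+s) := by
      intro x hx
      obtain ⟨w, hw, hx⟩ := Finset.mem_biUnion.1 hx
      simp only [Finset.mem_insert] at hw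
      rcases hw with rfl | rfl | hw
      · rw [ψu] at hx; exact su hx
      · rw [ψv] at hx; exact sv hx
      · rw [ψw w hw] at hx
        exact Finset.mem_union_left _ (Finset.mem_biUnion.2 ⟨w, hw, hx⟩)
    refine (Finset.card_le_card this).trans ((Finset.card_union_le _ _).trans ?_)
    rw [Nat.card_Ico]; omega
  · intro w hw
    simp only [Finset.mem_insert] at hw
    rcases hw with rfl | rfl | hw
    · rw [ψu, cu]
    · rw [ψv, cv]
    · rw [ψw w hw]; have := hs w hw; omega

/-- The connecting colors for a new vertex `t`. -/
lemma conn {V : Type*} {A : V → V → Prop} {S : Finset V} {φ : V → Finset ℕ}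
    (c : V → ℕ) (t : V)
    (ht : ∀ x ∈ S, ∀ w ∈ S, A x t → ¬ A w t → c x ∉ insert (c w) (φ w)) :
    ∃ C : Finset ℕ, C ⊆ S.biUnion (fun w => insert (c w) (φ w)) ∧
      (∀ w ∈ S, (insert (c w) (φ w) ∩ C).Nonempty ↔ A w t) ∧ C.card ≤ S.card ∧
      ((∃ w ∈ S, A w t) → 1 ≤ C.card) := by
  classical
  refine ⟨(S.filter (A · t)).image c, ?_, ?_, ?_, ?_⟩
  · intro y hy
    obtain ⟨x, hx, rfl⟩ := Finset.mem_image.1 hy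
    exact Finset.mem_biUnion.2 ⟨x, (Finset.mem_filter.1 hx).1, Finset.mem_insert_self _ _⟩
  · intro w hw
    constructor
    · rintro ⟨y, hy⟩
      obtain ⟨h1, h2⟩ := Finset.mem_inter.1 hy
      obtain ⟨x, hx, rfl⟩ := Finset.mem_image.1 h2
      obtain ⟨hx, hxt⟩ := Finset.mem_filter.1 hx
      by_contra hwt
      exact ht x hx w hw hxt hwt h1
    · intro hwt
      exact ⟨c w, Finset.mem_inter.2 ⟨Finset.mem_insert_self _ _,
        Finset.mem_image_of_mem _ (Finset.mem_filter.2 ⟨hw, hwt⟩)⟩⟩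
  · exact Finset.card_image_le.trans (Finset.card_filter_le _ _)
  · rintro ⟨w, hw, hwt⟩
    exact Finset.card_pos.2 ⟨c w, Finset.mem_image_of_mem _ (Finset.mem_filter.2 ⟨hw, hwt⟩)⟩

lemma incr_card {V : Type*} [DecidableEq V] {S : Finset V} {φ : V → Finset ℕ} (c : V → ℕ) :
    (S.biUnion (fun w => insert (c w) (φ w))).card ≤ (S.biUnion φ).card + S.card := by
  have : S.biUnion (fun w => insert (c w) (φ w)) ⊆ S.biUnion φ ∪ S.image c := by
    intro x hx
    obtain ⟨w, hw, hx⟩ := Finset.mem_biUnion.1 hx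
    rcases Finset.mem_insert.1 hx with rfl | hx
    · exact Finset.mem_union_right _ (Finset.mem_image_of_mem _ hw)
    · exact Finset.mem_union_left _ (Finset.mem_biUnion.2 ⟨w, hw, hx⟩)
  have h1 := Finset.card_le_card this
  have h2 := Finset.card_union_le (S.biUnion φ) (S.image c)
  have h3 : (S.image c).card ≤ S.card := Finset.card_image_le
  omega

/-- Saving a color when one increment is redundant. -/
lemma incr_card' {V : Type*} [DecidableEq V] {S : Finset V} {φ : V → Finset ℕ} (c : V → ℕ)
    (a b : V) (ha : a ∈ S) (hb : b ∈ S) (hab : a ≠ b) (h : c a ∈ insert (c b) (φ b)) :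
    (S.biUnion (fun w => insert (c w) (φ w))).card + 1 ≤ (S.biUnion φ).card + S.card := by
  have : S.biUnion (fun w => insert (c w) (φ w)) ⊆ S.biUnion φ ∪ (S.erase a).image c := by
    intro x hx
    obtain ⟨w, hw, hx⟩ := Finset.mem_biUnion.1 hx
    rcases Finset.mem_insert.1 hx with rfl | hx
    · by_cases hwa : w = a
      · subst hwa
        rcases Finset.mem_insert.1 h with h | h
        · rw [h]
          exact Finset.mem_union_right _
            (Finset.mem_image_of_mem _ (Finset.mem_erase.2 ⟨hab.symm, hb⟩))
        · exact Finset.mem_union_left _ (Finset.mem_biUnion.2 ⟨b, hb, h⟩)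
      · exact Finset.mem_union_right _ (Finset.mem_image_of_mem _ (Finset.mem_erase.2 ⟨hwa, hw⟩))
    · exact Finset.mem_union_left _ (Finset.mem_biUnion.2 ⟨w, hw, hx⟩)
  have h1 := Finset.card_le_card this
  have h2 := Finset.card_union_le (S.biUnion φ) ((S.erase a).image c)
  have h3 : ((S.erase a).image c).card ≤ (S.erase a).card := Finset.card_image_le
  have h4 := Finset.card_erase_add_one ha
  omega

/-- Increment and add an adjacent pair. -/
lemma step_adj {V : Type*} [DecidableEq V] {A : V → V → Prop} {S : Finset V} {φ : V → Finset ℕ}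
    (h : RepOn A S φ) {u v : V} (huv : u ≠ v) (huS : u ∉ S) (hvS : v ∉ S) (s q : ℕ)
    (hs : ∀ w ∈ S, (φ w).card + 1 < s)
    (c : V → ℕ) (hc : ∀ w ∈ S, c w ∉ φ w)
    (hcc : ∀ w ∈ S, ∀ x ∈ S, w ≠ x → c w ∈ insert (c x) (φ x) → A w x ∨ A x w)
    (hu : ∀ x ∈ S, ∀ w ∈ S, A x u → ¬ A w u → c x ∉ insert (c w) (φ w))
    (hv : ∀ x ∈ S, ∀ w ∈ S, A x v → ¬ A w v → c x ∉ insert (c w) (φ w))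
    (hSs : S.card < s) (ha : A u v) (hau : ∀ w ∈ S, ¬ A u w)
    (hav : ∀ w ∈ S, ¬ A v w) (hvu : ¬ A v u) (huu : ¬ A u u) (hvv : ¬ A v v)
    (hq : s ≤ q ∨ (s ≤ q + 1 ∧ (∃ w ∈ S, A w u) ∧ ∃ w ∈ S, A w v)) :
    ∃ ψ : V → Finset ℕ, RepOn A (insert u (insert v S)) ψ ∧
      ((insert u (insert v S)).biUnion ψ).card ≤
        (S.biUnion (fun w => insert (c w) (φ w))).card + 1 + q ∧
      (∀ w ∈ insert u (insert v S), (ψ w).card ≤ s + 1) ∧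
      ∃ p ∈ ψ v, ∀ w ∈ insert u (insert v S), w ≠ v → p ∉ ψ w := by
  obtain ⟨Cu, u1, u2, u3, u4⟩ := conn c u hu
  obtain ⟨Cv, v1, v2, v3, v4⟩ := conn c v hv
  refine ext_adj (incr h c hc hcc) huv huS hvS s q ?_ Cu Cv u1 v1 u2 v2 (by omega) (by omega)
    ha hau hav hvu huu hvv ?_ ?_
  · intro w hw
    have := hs w hw
    simp only [Finset.card_insert_of_notMem (hc w hw)]
    omega
  · rcases hq with hq | ⟨hq, h1, h2⟩
    · omega
    · have := u4 h1; omega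
  · rcases hq with hq | ⟨hq, h1, h2⟩
    · omega
    · have := v4 h2; omega

lemma step_main {n : ℕ} {A : Fin n → Fin n → Prop} (hac : ¬ HasDirCycle A) (m : ℕ)
    (IH : ∀ S : Finset (Fin n), S.card = 2 * m → GoodOn A S m)
    (S : Finset (Fin n)) (hS : S.card = 2 * (m + 1)) : GoodOn A S (m + 1) := by
  obtain ⟨v, hvS, hv⟩ := exists_sink hac S (Finset.card_pos.1 (by omega))
  have loop := no_loop hac
  -- removing two vertices
  have rem : ∀ u ∈ S, u ≠ v → ∃ W : Finset (Fin n), u ∉ W ∧ v ∉ W ∧ W.card = 2 * m ∧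
      S = insert u (insert v W) := by
    intro u hu huv
    refine ⟨(S.erase v).erase u, by simp, by simp, ?_, ?_⟩
    · rw [Finset.card_erase_of_mem (Finset.mem_erase.2 ⟨huv, hu⟩), Finset.card_erase_of_mem hvS]
      omega
    · rw [Finset.insert_comm, Finset.insert_erase (Finset.mem_erase.2 ⟨huv, hu⟩),
        Finset.insert_erase hvS]
  by_cases h2 : ∃ u ∈ S, u ≠ v ∧ ∀ w ∈ S, ¬ A u w
  · obtain ⟨u, huS, huv, hu⟩ := h2
    obtain ⟨W, huW, hvW, hW, rfl⟩ := rem u huS huv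
    obtain ⟨φ, hφ, hK, hsz, -⟩ := IH W hW
    obtain ⟨N, hN⟩ := exists_bound W φ
    let c : Fin n → ℕ := fun w => N + w.val
    have hcφ : ∀ x, ∀ w ∈ W, c x ∉ φ w := fun x w hw hx => by
      have := hN w hw _ hx
      simp only [c] at this; omega
    have hcinj : ∀ x, ∀ w ∈ W, c x ∈ insert (c w) (φ w) → x = w := by
      intro x w hw hx
      rcases Finset.mem_insert.1 hx with hx | hx
      · simp only [c] at hx; exact Fin.ext (by omega)
      · exact absurd hx (hcφ x w hw)
    have hcc : ∀ t, ∀ x ∈ W, ∀ w ∈ W, A x t → ¬ A w t → c x ∉ insert (c w) (φ w) := by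
      intro t x hx w hw h1 h2 h3
      rw [hcinj x w hw h3] at h1
      exact h2 h1
    obtain ⟨Cu, u1, u2, u3, -⟩ := conn c u (hcc u)
    obtain ⟨Cv, v1, v2, v3, -⟩ := conn c v (hcc v)
    obtain ⟨ψ, hψ, hc, hs⟩ := ext_non
      (incr hφ c (fun w hw => hcφ w w hw) (fun w hw x hx hne h => absurd (hcinj w x hx h) hne))
      huv huW hvW (3 * m + 1) (fun w hw => by
        have := hsz w hw
        simp only [Finset.card_insert_of_notMem (hcφ w w hw)]
        omega) Cu Cv u1 v1 u2 v2 (by omega) (by omega) (hu v (by simp))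
      (fun w hw => hu w (by simp [hw])) (fun w hw => hv w (by simp [hw])) (hv u (by simp))
      (loop u) (loop v)
    have := incr_card (S := W) (φ := φ) c
    refine ⟨ψ, hψ, by nlinarith, fun w hw => ?_, Or.inl fun w hw => ?_⟩
    · have := hs w hw; omega
    · have := hs w hw; omega
  push Not at h2
  by_cases harc : ∃ x ∈ S.erase v, ∃ y ∈ S.erase v, A x y
  swap
  · -- star
    push Not at harc
    have hstar : ∀ w ∈ S, w ≠ v → A w v := by
      intro w hw hwv
      obtain ⟨x, hx, hwx⟩ := h2 w hw hwv
      by_cases hxv : x = v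
      · rwa [hxv] at hwx
      · exact absurd hwx (harc w (Finset.mem_erase.2 ⟨hwv, hw⟩) x (Finset.mem_erase.2 ⟨hxv, hx⟩))
    obtain ⟨u, hu, huv⟩ : ∃ u ∈ S, u ≠ v := Finset.exists_mem_ne (by omega) v
    let ψ : Fin n → Finset ℕ := fun w => if w = v then {0, 1} else {0}
    have ψv : ψ v = {0, 1} := by simp [ψ]
    have ψw : ∀ w, w ≠ v → ψ w = {0} := fun w hw => by simp [ψ, hw]
    have hle : ∀ w, ψ w ⊆ {0, 1} := by
      intro w
      by_cases hw : w = v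
      · rw [hw, ψv]
      · rw [ψw w hw]; simp
    refine ⟨ψ, ⟨?_, ?_⟩, ?_, ?_, Or.inr ⟨u, hu, v, hvS, 1, hstar u hu huv, hv, by simp [ψv], ?_⟩⟩
    · intro w hw
      refine ⟨0, ?_⟩
      by_cases hw : w = v
      · rw [hw, ψv]; simp
      · rw [ψw w hw]; simp
    · intro x hx y hy
      by_cases hxv : x = v
      · subst hxv
        have h3 := Finset.card_le_card (hle y)
        rw [ψv]
        simp only [hv y hy, false_iff, not_and, not_lt]
        intro _; exact h3
      · by_cases hyv : y = v
        · subst hyv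
          rw [ψw x hxv, ψv]
          simp [hstar x hx hxv]
        · rw [ψw x hxv, ψw y hyv]
          simp [harc x (Finset.mem_erase.2 ⟨hxv, hx⟩) y (Finset.mem_erase.2 ⟨hyv, hy⟩)]
    · have : S.biUnion ψ ⊆ {0, 1} := Finset.biUnion_subset.2 fun w _ => hle w
      have h3 := Finset.card_le_card this
      have h4 : ({0, 1} : Finset ℕ).card = 2 := rfl
      rw [h4] at h3
      nlinarith
    · intro w hw
      have h3 := Finset.card_le_card (hle w)
      have h4 : ({0, 1} : Finset ℕ).card = 2 := rfl
      omega
    · intro w hw hwv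
      rw [ψw w hwv]; simp
  -- unique sink, with an arc avoiding it
  classical
  obtain ⟨u, huT, huT'⟩ := exists_sink hac
    ((S.erase v).filter (fun y => ∃ x ∈ S.erase v, A x y)) (by
      obtain ⟨x, hx, y, hy, hxy⟩ := harc
      exact ⟨y, Finset.mem_filter.2 ⟨hy, x, hx, hxy⟩⟩)
  obtain ⟨huSv, x, hxSv, hxu⟩ := Finset.mem_filter.1 huT
  obtain ⟨huv, huS⟩ := Finset.mem_erase.1 huSv
  obtain ⟨hxv, hxS⟩ := Finset.mem_erase.1 hxSv
  have hu : ∀ w ∈ S, w ≠ v → ¬ A u w := fun w hw hwv h =>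
    huT' w (Finset.mem_filter.2 ⟨Finset.mem_erase.2 ⟨hwv, hw⟩, u, huSv, h⟩) h
  have ha : A u v := by
    obtain ⟨y, hy, huy⟩ := h2 u huS huv
    by_cases hyv : y = v
    · rwa [hyv] at huy
    · exact absurd huy (hu y hy hyv)
  obtain ⟨W, huW, hvW, hW, rfl⟩ := rem u huS huv
  have hxu' : x ≠ u := by rintro rfl; exact loop _ hxu
  have hxW : x ∈ W := by simpa [hxv, hxu'] using hxS
  have hm : 1 ≤ m := by
    have := Finset.card_pos.2 ⟨x, hxW⟩
    omega
  have hau : ∀ w ∈ W, ¬ A u w := fun w hw => hu w (by simp [hw]) (by rintro rfl; exact hvW hw)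
  have hav : ∀ w ∈ W, ¬ A v w := fun w hw => hv w (by simp [hw])
  have hvu : ¬ A v u := hv u (by simp)
  obtain ⟨φ, hφ, hK, hsz, hst⟩ := IH W hW
  obtain ⟨N, hN⟩ := exists_bound W φ
  -- closing argument
  have fin : ∀ K : ℕ, K ≤ (W.biUnion φ).card + (5 * m + 1) →
      (∃ ψ : Fin n → Finset ℕ, RepOn A (insert u (insert v W)) ψ ∧
      ((insert u (insert v W)).biUnion ψ).card ≤ K ∧
      (∀ w ∈ insert u (insert v W), (ψ w).card ≤ 3 * m + 2) ∧
      ∃ p ∈ ψ v, ∀ w ∈ insert u (insert v W), w ≠ v → p ∉ ψ w) →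
      GoodOn A (insert u (insert v W)) (m + 1) := by
    rintro K hK' ⟨ψ, hψ, hc, hs, p, hp, hp'⟩
    refine ⟨ψ, hψ, by nlinarith, fun w hw => ?_,
      Or.inr ⟨u, by simp, v, by simp, p, ha, hv, hp, hp'⟩⟩
    have := hs w hw; omega
  let c : Fin n → ℕ := fun w => N + w.val
  have hcφ : ∀ x, ∀ w ∈ W, c x ∉ φ w := fun x w hw hx => by
    have := hN w hw _ hx
    simp only [c] at this; omega
  have hci : ∀ x w, c x = c w → x = w := fun x w h => by
    simp only [c] at h; exact Fin.ext (by omega)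
  have hcinj : ∀ x, ∀ w ∈ W, c x ∈ insert (c w) (φ w) → x = w := by
    intro x w hw hx
    rcases Finset.mem_insert.1 hx with hx | hx
    · exact hci x w hx
    · exact absurd hx (hcφ x w hw)
  have hcc : ∀ t, ∀ x ∈ W, ∀ w ∈ W, A x t → ¬ A w t → c x ∉ insert (c w) (φ w) := by
    intro t x hx w hw h1 h2 h3
    rw [hcinj x w hw h3] at h1
    exact h2 h1
  have hfresh := incr_card (S := W) (φ := φ) c
  by_cases hgood : ∃ w ∈ W, A w v
  · refine fin _ ?_ (step_adj hφ huv huW hvW (3 * m + 1) (3 * m)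
      (fun w hw => by have := hsz w hw; omega) c (fun w hw => hcφ w w hw)
      (fun w hw x hx hne h => absurd (hcinj w x hx h) hne) (hcc u) (hcc v) (by omega) ha hau hav
      hvu (loop u) (loop v) (Or.inr ⟨le_refl _, ⟨x, hxW, hxu⟩, hgood⟩))
    omega
  push Not at hgood
  rcases hst with hT | ⟨a, haW, b, hbW, p, hab, hb, hpb, hp⟩
  · obtain ⟨ψ, e1, e2, e3, e4⟩ := step_adj hφ huv huW hvW (3 * m) (3 * m)
      (fun w hw => by have := hT w hw; omega) c (fun w hw => hcφ w w hw)
      (fun w hw x hx hne h => absurd (hcinj w x hx h) hne) (hcc u) (hcc v) (by omega) ha hau hav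
      hvu (loop u) (loop v) (Or.inl le_rfl)
    exact fin _ (by omega) ⟨ψ, e1, e2, fun w hw => (e3 w hw).trans (by omega), e4⟩
  have hne : a ≠ b := by rintro rfl; exact loop _ hab
  have hbu : A b u := by
    obtain ⟨y, hy, hby⟩ := h2 b (by simp [hbW]) (by rintro rfl; exact hvW hbW)
    simp only [Finset.mem_insert] at hy
    rcases hy with rfl | rfl | hy
    · exact hby
    · exact absurd hby (hgood b hbW)
    · exact absurd hby (hb y hy)
  -- the modified increments
  have fin2 : ∀ d : Fin n → ℕ, (∀ w, w ≠ a → d w = c w) → d a ∉ φ a →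
      (∀ w ∈ W, w ≠ a → w ≠ b → d a ∉ insert (c w) (φ w)) → d a ∈ insert (c b) (φ b) →
      (∀ w ∈ W, A w u → ¬ A a u → d a ≠ c w) →
      (¬ A a u ∨ d a ∉ φ b ∧ A a u) →
      GoodOn A (insert u (insert v W)) (m + 1) := by
    intro d hd hda hdw hdb hda2 hda3
    have hsave := incr_card' (S := W) (φ := φ) d a b haW hbW hne (by rw [hd b hne.symm]; exact hdb)
    refine fin _ ?_ (step_adj hφ huv huW hvW (3 * m + 1) (3 * m + 1)
      (fun w hw => by have := hsz w hw; omega) d ?_ ?_ ?_ ?_ (by omega) ha hau hav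
      hvu (loop u) (loop v) (Or.inl le_rfl))
    · omega
    · intro w hw
      by_cases hwa : w = a
      · rw [hwa]; exact hda
      · rw [hd w hwa]; exact hcφ w w hw
    · intro w hw y hy hwy hmem
      by_cases hwa : w = a
      · subst hwa
        by_cases hyb : y = b
        · rw [hyb]; exact Or.inl hab
        · rw [hd y hwy.symm] at hmem
          exact absurd hmem (hdw y hy hwy.symm hyb)
      · rw [hd w hwa] at hmem
        by_cases hya : y = a
        · subst hya
          rcases Finset.mem_insert.1 hmem with hmem | hmem
          · by_cases hwb : w = b
            · rw [hwb]; exact Or.inr hab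
            · exact absurd (by rw [hmem]; exact Finset.mem_insert_self _ _) (hdw w hw hwa hwb)
          · exact absurd hmem (hcφ w y hy)
        · rw [hd y hya] at hmem
          exact absurd (hcinj w y hy hmem) hwy
    · intro y hy w hw hyu hwu hmem
      by_cases hya : y = a
      · subst hya
        have hwy : w ≠ y := by rintro rfl; exact hwu hyu
        have hwb : w ≠ b := by rintro rfl; exact hwu hbu
        rw [hd w hwy] at hmem
        exact hdw w hw hwy hwb hmem
      · rw [hd y hya] at hmem
        by_cases hwa : w = a
        · subst hwa
          rcases Finset.mem_insert.1 hmem with hmem | hmem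
          · exact hda2 y hy hyu hwu hmem.symm
          · exact hcφ y w hw hmem
        · rw [hd w hwa] at hmem
          rw [hcinj y w hw hmem] at hyu
          exact hwu hyu
    · intro y hy w hw hyv
      exact absurd hyv (hgood y hy)
  by_cases hau' : A a u
  · refine fin2 (fun w => if w = a then c b else c w) (fun w hw => by simp [hw]) ?_ ?_ ?_ ?_ ?_
    · simpa using hcφ b a haW
    · intro w hw hwa hwb h
      simp only [if_true] at h
      exact hwb (hcinj b w hw h).symm
    · simp
    · intro w hw _ h; exact absurd hau' h
    · right; simpa using ⟨hcφ b b hbW, hau'⟩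
  · have hpN := hN b hbW p hpb
    refine fin2 (fun w => if w = a then p else c w) (fun w hw => by simp [hw]) ?_ ?_ ?_ ?_ ?_
    · simpa using hp a haW hne
    · intro w hw hwa hwb h
      simp only [if_true] at h
      rcases Finset.mem_insert.1 h with h | h
      · simp only [c] at h; omega
      · exact hp w hw hwb h
    · simp [hpb]
    · intro w hw _ _ h
      simp only [if_true, c] at h; omega
    · exact Or.inl hau'

lemma good_all {n : ℕ} {A : Fin n → Fin n → Prop} (hac : ¬ HasDirCycle A) (m : ℕ) :
    ∀ S : Finset (Fin n), S.card = 2 * m → GoodOn A S m := by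
  induction m with
  | zero =>
    intro S hS
    have : S = ∅ := Finset.card_eq_zero.1 (by omega)
    subst this
    exact ⟨fun _ => ∅, ⟨by simp, by simp⟩, by simp, by simp, Or.inl (by simp)⟩
  | succ m ih => exact step_main hac m ih

/-- For every DAG on an even number `n` of vertices, `DIN(D) ≤ 5n²/8 − 3n/4 + 1`. -/
theorem stmt_3 (n : ℕ) (hn : Even n) (A : Fin n → Fin n → Prop) (hacyc : ¬ HasDirCycle A) :
    ∃ φ : Fin n → Finset ℕ, IsDIRep A φ ∧
      ((Finset.univ.biUnion φ).card : ℚ) ≤ 5 * n ^ 2 / 8 - 3 * n / 4 + 1 := by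
  obtain ⟨m, hm⟩ := hn
  obtain ⟨φ, hφ, hK, -, -⟩ := good_all hacyc m Finset.univ (by simp; omega)
  refine ⟨φ, ⟨fun v => hφ.1 v (Finset.mem_univ _),
    fun u v => hφ.2 u (Finset.mem_univ _) v (Finset.mem_univ _)⟩, ?_⟩
  have h1 : (2 * ((Finset.univ.biUnion φ).card : ℚ) + 3 * m ≤ 5 * m ^ 2 + 2) := by
    exact_mod_cast hK
  have h2 : (n : ℚ) = m + m := by exact_mod_cast hm
  rw [h2]
  nlinarith
end

section
/- For even n ≥ 8, there exists a directed acyclic graph on n vertices whose directed intersection number equals n²/2 + ⌊n²/16 − n/4 + 1/4⌋ − 1. -/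
/-- Adjacency (for `i < j`) of the extremal digraph. -/
def AdjX (p i j : ℕ) : Prop :=
  j = i + 1 ∨ (i = 0 ∧ j % 2 = 1) ∨
    (i % 2 = 0 ∧ j % 2 = 0 ∧ 1 ≤ i / 2 ∧ i / 2 ≤ p ∧ p < j / 2)

lemma din_lower (m p q : ℕ) (hm : m = p + q + 1) (hp : 1 ≤ p) (hq : 1 ≤ q)
    (ψ : ℕ → Finset ℕ)
    (hadj : ∀ i j, i < j → j < 2 * m → AdjX p i j →
      (ψ i ∩ ψ j).Nonempty ∧ (ψ i).card < (ψ j).card)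
    (hnon : ∀ i j, i < j → j < 2 * m → ¬ AdjX p i j →
      (ψ i).card < (ψ j).card → ¬ (ψ i ∩ ψ j).Nonempty) :
    2 * m ^ 2 + p * q ≤ ((Finset.range (2 * m)).biUnion ψ).card + 1 := by
  have hstep : ∀ i, i + 1 < 2 * m → (ψ i).card < (ψ (i + 1)).card := fun i hi =>
    (hadj i (i + 1) (by omega) hi (Or.inl rfl)).2
  have hmono : ∀ d i, i + d < 2 * m → (ψ i).card + d ≤ (ψ (i + d)).card := by
    intro d
    induction d with
    | zero => intro i _; simp
    | succ d ih =>
      intro i hi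
      have h1 := ih i (by omega)
      have h2 := hstep (i + d) (by omega)
      have h3 : i + (d + 1) = i + d + 1 := by omega
      rw [h3]
      omega
  have hlt : ∀ i j, i < j → j < 2 * m → (ψ i).card < (ψ j).card := by
    intro i j hij hj
    have := hmono (j - i) i (by omega)
    rw [show i + (j - i) = j by omega] at this
    omega
  have hdisj : ∀ i j, i < j → j < 2 * m → ¬ AdjX p i j → Disjoint (ψ i) (ψ j) := by
    intro i j hij hj hA
    have := hnon i j hij hj hA (hlt i j hij hj)
    rwa [Finset.not_nonempty_iff_eq_empty, ← Finset.disjoint_iff_inter_eq_empty] at this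
  have hdisj_a : ∀ i j x, i ≠ j → i < 2 * m → j < 2 * m → ¬ AdjX p i j → ¬ AdjX p j i →
      x ∈ ψ i → x ∈ ψ j → False := by
    intro i j x hne hi hj h1 h2 hx hy
    rcases lt_or_gt_of_ne hne with h | h
    · exact Finset.disjoint_left.1 (hdisj i j h hj h1) hx hy
    · exact Finset.disjoint_left.1 (hdisj j i h hi h2) hy hx
  have hodd : ∀ k l x, k ≠ l → k < m → l < m → x ∈ ψ (2 * k + 1) → x ∈ ψ (2 * l + 1) →
      False := by
    intro k l x hkl hk hl
    apply hdisj_a <;> first | omega | (unfold AdjX; omega)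
  have h0 : m ≤ (ψ 0).card := by
    have hsub : (Finset.range m).biUnion (fun k => ψ 0 ∩ ψ (2 * k + 1)) ⊆ ψ 0 := by
      intro x hx
      simp only [Finset.mem_biUnion, Finset.mem_inter] at hx
      obtain ⟨k, _, h, _⟩ := hx
      exact h
    refine le_trans ?_ (Finset.card_le_card hsub)
    rw [Finset.card_biUnion]
    · calc m = ∑ k ∈ Finset.range m, 1 := by simp
        _ ≤ _ := by
          apply Finset.sum_le_sum
          intro k hk
          have hk := Finset.mem_range.1 hk
          exact Finset.card_pos.2
            (hadj 0 (2 * k + 1) (by omega) (by omega) (by unfold AdjX; omega)).1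
    · intro k hk l hl hkl
      rw [Finset.mem_coe, Finset.mem_range] at *
      rw [Function.onFun, Finset.disjoint_left]
      intro x hx hy
      exact hodd k l x hkl hk hl (Finset.mem_inter.1 hx).2 (Finset.mem_inter.1 hy).2
  have hsz : ∀ i, i < 2 * m → m + i ≤ (ψ i).card := by
    intro i hi
    have := hmono i 0 (by omega)
    rw [zero_add] at this
    omega
  set U := (Finset.range m).biUnion (fun k => ψ (2 * k + 1)) with hU
  set I := ((Finset.Icc 1 p) ×ˢ (Finset.Ico (p + 1) m)).erase (p, p + 1) with hI
  set W := I.biUnion (fun ab => ψ (2 * ab.1) ∩ ψ (2 * ab.2)) with hW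
  have hIc : I.card + 1 = p * q := by
    rw [hI, Finset.card_erase_add_one, Finset.card_product]
    · simp
      left; omega
    · simp; omega
  have hIm : ∀ ab ∈ I, 1 ≤ ab.1 ∧ ab.1 ≤ p ∧ p + 1 ≤ ab.2 ∧ ab.2 < m ∧
      ¬ (ab.1 = p ∧ ab.2 = p + 1) := by
    rintro ⟨a, b⟩ hab
    simp only [hI, Finset.mem_erase, Finset.mem_product, Finset.mem_Icc, Finset.mem_Ico, ne_eq,
      Prod.mk.injEq] at hab
    simp only
    tauto
  have hUc : 2 * m ^ 2 ≤ U.card := by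
    rw [hU, Finset.card_biUnion]
    · calc 2 * m ^ 2 = ∑ k ∈ Finset.range m, (m + (2 * k + 1)) := by
            have : ∀ N, ∑ k ∈ Finset.range N, (m + (2 * k + 1)) = N * m + N ^ 2 := by
              intro N
              induction N with
              | zero => simp
              | succ N ih => rw [Finset.sum_range_succ, ih]; ring
            rw [this]; ring
        _ ≤ _ := by
          apply Finset.sum_le_sum
          intro k hk
          have hk := Finset.mem_range.1 hk
          exact hsz _ (by omega)
    · intro k hk l hl hkl
      rw [Finset.mem_coe, Finset.mem_range] at *
      rw [Function.onFun, Finset.disjoint_left]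
      intro x hx hy
      exact hodd k l x hkl hk hl hx hy
  have hWc : I.card ≤ W.card := by
    rw [hW, Finset.card_biUnion]
    · calc I.card = ∑ k ∈ I, 1 := by simp
        _ ≤ _ := by
          apply Finset.sum_le_sum
          intro ab hab
          have := hIm ab hab
          exact Finset.card_pos.2
            (hadj (2 * ab.1) (2 * ab.2) (by omega) (by omega) (by unfold AdjX; omega)).1
    · rintro ⟨a, b⟩ hab ⟨a_a, b_a⟩ hab_a hne
      have h1 := hIm _ hab
      have h2 := hIm _ hab_a
      simp only at h1 h2
      rw [Function.onFun, Finset.disjoint_left]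
      intro x hx hy
      simp only [Finset.mem_inter] at hx hy
      by_cases haa : a = a_a
      · have hbb : b ≠ b_a := by
          rintro rfl; exact hne (by rw [haa])
        refine hdisj_a (2 * b) (2 * b_a) x ?_ ?_ ?_ ?_ ?_ hx.2 hy.2 <;>
          first | omega | (unfold AdjX; omega)
      · refine hdisj_a (2 * a) (2 * a_a) x ?_ ?_ ?_ ?_ ?_ hx.1 hy.1 <;>
          first | omega | (unfold AdjX; omega)
  have hUW : Disjoint U W := by
    rw [Finset.disjoint_left]
    intro x hx hy
    simp only [hU, hW, Finset.mem_biUnion, Finset.mem_inter, Finset.mem_range] at hx hy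
    obtain ⟨k, hk, hxk⟩ := hx
    obtain ⟨⟨a, b⟩, hab, hxa, hxb⟩ := hy
    have h1 := hIm _ hab
    simp only at h1 hxa hxb
    by_cases hc : k = a ∨ k + 1 = a
    · refine hdisj_a (2 * k + 1) (2 * b) x ?_ ?_ ?_ ?_ ?_ hxk hxb <;>
        first | omega | (unfold AdjX; omega)
    · refine hdisj_a (2 * k + 1) (2 * a) x ?_ ?_ ?_ ?_ ?_ hxk hxa <;>
        first | omega | (unfold AdjX; omega)
  have hsub : U ∪ W ⊆ (Finset.range (2 * m)).biUnion ψ := by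
    intro x hx
    simp only [hU, hW, Finset.mem_union, Finset.mem_biUnion, Finset.mem_inter,
      Finset.mem_range] at hx ⊢
    rcases hx with ⟨k, hk, hxk⟩ | ⟨ab, hab, hxa, hxb⟩
    · exact ⟨_, by omega, hxk⟩
    · have := hIm ab hab
      exact ⟨2 * ab.1, by omega, hxa⟩
  have := Finset.card_le_card hsub
  rw [Finset.card_union_of_disjoint hUW] at this
  omega

/-- Token of the pair `(a, b)`. -/
def tok (m p a b : ℕ) : ℕ × ℕ := if a = p ∧ b = p + 1 then (p, m + 2 * p) else (m + a, b)

/-- Tokens of pairs at the vertex `2 j`. -/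
def pqTok (m p j : ℕ) : Finset (ℕ × ℕ) :=
  if j ≤ p then (Finset.Ico (p + 1) m).image (fun b => tok m p j b)
  else (Finset.Icc 1 p).image (fun a => tok m p a j)

/-- Representation by tokens. -/
def rep (m p q v : ℕ) : Finset (ℕ × ℕ) :=
  if v % 2 = 1 then {v / 2} ×ˢ Finset.range (m + v)
  else if v = 0 then Finset.range m ×ˢ {0}
  else ({(v / 2 - 1, 1)} ∪ {v / 2} ×ˢ Finset.Ico 2 (m + v + 1 - (if v / 2 ≤ p then q else p)))
    ∪ pqTok m p (v / 2)

lemma mem_pqTok (m p j x y : ℕ) : (x, y) ∈ pqTok m p j ↔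
    ((j = p ∧ p + 1 < m ∨ j = p + 1 ∧ 1 ≤ p) ∧ x = p ∧ y = m + 2 * p) ∨
    (j ≤ p ∧ x = m + j ∧ p + 1 ≤ y ∧ y < m ∧ ¬ (j = p ∧ y = p + 1)) ∨
    (p < j ∧ y = j ∧ m + 1 ≤ x ∧ x ≤ m + p ∧ ¬ (x = m + p ∧ j = p + 1)) := by
  unfold pqTok tok
  split_ifs with h
  · simp only [Finset.mem_image, Finset.mem_Ico]
    constructor
    · rintro ⟨b, hb, he⟩
      split_ifs at he <;> simp only [Prod.mk.injEq] at he <;> omega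
    · rintro (⟨h1, h2, h3⟩ | h1 | h1)
      · exact ⟨p + 1, by omega, by rw [if_pos (by omega), h2, h3]⟩
      · exact ⟨y, by omega, by rw [if_neg (by omega), h1.2.1]⟩
      · omega
  · simp only [Finset.mem_image, Finset.mem_Icc]
    constructor
    · rintro ⟨b, hb, he⟩
      split_ifs at he <;> simp only [Prod.mk.injEq] at he <;> omega
    · rintro (⟨h1, h2, h3⟩ | h1 | h1)
      · exact ⟨p, by omega, by rw [if_pos (by omega), h2, h3]⟩
      · omega
      · exact ⟨x - m, by omega, by
          rw [if_neg (by omega), Prod.mk.injEq]; omega⟩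

lemma card_pqTok (m p q j : ℕ) (hm : m = p + q + 1) :
    (pqTok m p j).card = if j ≤ p then q else p := by
  unfold pqTok
  split_ifs with h
  · rw [Finset.card_image_of_injOn]
    · simp; omega
    · intro b hb b_a hb_a he
      simp only [Finset.coe_Ico, Set.mem_Ico] at hb hb_a
      simp only [tok] at he
      split_ifs at he <;> simp only [Prod.mk.injEq] at he <;> omega
  · rw [Finset.card_image_of_injOn]
    · simp
    · intro b hb b_a hb_a he
      simp only [Finset.coe_Icc, Set.mem_Icc] at hb hb_a
      simp only [tok] at he
      split_ifs at he <;> simp only [Prod.mk.injEq] at he <;> omega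

lemma mem_rep (m p q v x y : ℕ) : (x, y) ∈ rep m p q v ↔
    (v % 2 = 1 ∧ x = v / 2 ∧ y < m + v) ∨ (v = 0 ∧ x < m ∧ y = 0) ∨
    (v % 2 = 0 ∧ 0 < v ∧ ((x = v / 2 - 1 ∧ y = 1) ∨
      (x = v / 2 ∧ 2 ≤ y ∧ ((v / 2 ≤ p ∧ y + q < m + v + 1) ∨ (p < v / 2 ∧ y + p < m + v + 1))) ∨
      (x, y) ∈ pqTok m p (v / 2))) := by
  unfold rep
  split_ifs with h1 h2 h3
  · simp; omega
  · simp [h2, eq_comm]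
  · simp only [Finset.mem_union, Finset.mem_singleton, Finset.mem_product, Finset.mem_Ico,
      Prod.mk.injEq, or_assoc]
    have e1 : v % 2 = 0 := by omega
    have e2 : ¬ (p < v / 2) := by omega
    have e3 : 0 < v := by omega
    simp only [e1, h2, h3, e2, e3]
    simp [Nat.lt_sub_iff_add_lt]
  · simp only [Finset.mem_union, Finset.mem_singleton, Finset.mem_product, Finset.mem_Ico,
      Prod.mk.injEq, or_assoc]
    have e1 : v % 2 = 0 := by omega
    have e2 : p < v / 2 := by omega
    have e3 : 0 < v := by omega
    simp only [e1, h2, h3, e2, e3]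
    simp [Nat.lt_sub_iff_add_lt]

lemma card_rep (m p q v : ℕ) (hm : m = p + q + 1) (hp : 1 ≤ p) (hq : 1 ≤ q) (hm4 : 4 ≤ m)
    (hv : v < 2 * m) : (rep m p q v).card = m + v := by
  unfold rep
  split_ifs with h1 h2 h3
  · simp
  · simp [h2]
  all_goals
    rw [Finset.card_union_of_disjoint, Finset.card_union_of_disjoint, card_pqTok m p q _ hm]
    · simp [h3]; omega
    · rw [Finset.disjoint_left]
      rintro ⟨x, y⟩ hx hy
      simp only [Finset.mem_singleton, Finset.mem_product, Finset.mem_Ico, Prod.mk.injEq] at hx hy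
      omega
    · rw [Finset.disjoint_left]
      rintro ⟨x, y⟩ hx hy
      simp only [Finset.mem_union, mem_pqTok, Finset.mem_singleton, Finset.mem_product,
        Finset.mem_Ico, Prod.mk.injEq] at hx hy
      omega

lemma rep_adj (m p q i j : ℕ) (hm : m = p + q + 1) (hp : 1 ≤ p) (hq : 1 ≤ q) (hm4 : 4 ≤ m)
    (hij : i < j) (hj : j < 2 * m) : AdjX p i j ↔ (rep m p q i ∩ rep m p q j).Nonempty := by
  constructor
  · rintro (h | h | h)
    · by_cases hi : i = 0
      · refine ⟨(0, 0), ?_⟩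
        rw [Finset.mem_inter, mem_rep, mem_rep, mem_pqTok, mem_pqTok]
        omega
      by_cases hi2 : i % 2 = 0
      · refine ⟨(i / 2, 2), ?_⟩
        rw [Finset.mem_inter, mem_rep, mem_rep, mem_pqTok, mem_pqTok]
        omega
      · refine ⟨(i / 2, 1), ?_⟩
        rw [Finset.mem_inter, mem_rep, mem_rep, mem_pqTok, mem_pqTok]
        omega
    · refine ⟨(j / 2, 0), ?_⟩
      rw [Finset.mem_inter, mem_rep, mem_rep, mem_pqTok, mem_pqTok]
      omega
    · by_cases hb : i / 2 = p ∧ j / 2 = p + 1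
      · refine ⟨(p, m + 2 * p), ?_⟩
        rw [Finset.mem_inter, mem_rep, mem_rep, mem_pqTok, mem_pqTok]
        omega
      · refine ⟨(m + i / 2, j / 2), ?_⟩
        rw [Finset.mem_inter, mem_rep, mem_rep, mem_pqTok, mem_pqTok]
        omega
  · rintro ⟨⟨x, y⟩, h⟩
    simp only [Finset.mem_inter, mem_rep, mem_pqTok] at h
    unfold AdjX
    obtain ⟨h1, h2⟩ := h
    rcases h1 with h1 | h1 | ⟨h1, h1_a, h1_b | h1_b | h1_b | h1_b | h1_b⟩ <;>
    rcases h2 with h2 | h2 | ⟨h2, h2_a, h2_b | h2_b | h2_b | h2_b | h2_b⟩ <;> omega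

lemma rep_total (m p q : ℕ) (hm : m = p + q + 1) (hp : 1 ≤ p) (hq : 1 ≤ q) (hm4 : 4 ≤ m) :
    ((Finset.range (2 * m)).biUnion (rep m p q)).card + 1 ≤ 2 * m ^ 2 + p * q := by
  set I := ((Finset.Icc (m + 1) (m + p)) ×ˢ (Finset.Ico (p + 1) m)).erase (m + p, p + 1) with hI
  set U := (Finset.range m).biUnion
    (fun k => ({k} : Finset ℕ) ×ˢ Finset.range (m + (2 * k + 1))) with hU
  have hIc : I.card + 1 = p * q := by
    rw [hI, Finset.card_erase_add_one, Finset.card_product]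
    · simp
      left; omega
    · simp; omega
  have hUc : U.card ≤ 2 * m ^ 2 := by
    refine le_trans Finset.card_biUnion_le ?_
    simp only [Finset.card_product, Finset.card_singleton, Finset.card_range, one_mul]
    have : ∀ N, ∑ k ∈ Finset.range N, (m + (2 * k + 1)) = N * m + N ^ 2 := by
      intro N
      induction N with
      | zero => simp
      | succ N ih => rw [Finset.sum_range_succ, ih]; ring
    rw [this]
    apply le_of_eq; ring
  have hsub : (Finset.range (2 * m)).biUnion (rep m p q) ⊆ U ∪ I := by
    rintro ⟨x, y⟩ hx
    simp only [Finset.mem_biUnion, Finset.mem_range, mem_rep, mem_pqTok] at hx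
    obtain ⟨v, hv, h⟩ := hx
    have : (x < m ∧ y < m + (2 * x + 1)) ∨ (m + 1 ≤ x ∧ x ≤ m + p ∧ p + 1 ≤ y ∧ y < m ∧
        ¬ (x = m + p ∧ y = p + 1)) := by
      rcases h with h1 | h1 | ⟨h1, h1_a, h1_b | h1_b | h1_b | h1_b | h1_b⟩ <;> omega
    rw [Finset.mem_union]
    rcases this with h | h
    · left
      simp only [hU, Finset.mem_biUnion, Finset.mem_range, Finset.mem_product,
        Finset.mem_singleton]
      exact ⟨x, h.1, rfl, h.2⟩
    · right
      simp only [hI, Finset.mem_erase, Finset.mem_product, Finset.mem_Icc, Finset.mem_Ico, ne_eq,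
        Prod.mk.injEq]
      tauto
  have h1 := Finset.card_le_card hsub
  have h2 := Finset.card_union_le U I
  omega

/-- For even `n ≥ 8`, there exists a DAG on `n` vertices whose directed intersection
number equals `n²/2 + ⌊n²/16 − n/4 + 1/4⌋ − 1`. -/
theorem stmt_14 (n : ℕ) (hn : Even n) (hn8 : 8 ≤ n) :
    ∃ A : Fin n → Fin n → Prop, ¬ HasDirCycle A ∧
      IsLeast {k : ℤ | ∃ φ : Fin n → Finset ℕ, IsDIRep A φ ∧
          ((Finset.univ.biUnion φ).card : ℤ) = k}
        ((n : ℤ) ^ 2 / 2 + (⌊(n : ℚ) ^ 2 / 16 - (n : ℚ) / 4 + 1 / 4⌋ - 1)) := by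
  obtain ⟨m, rfl⟩ := hn
  obtain ⟨p, hpdef⟩ : ∃ p, p = (m - 1) / 2 := ⟨_, rfl⟩
  obtain ⟨q, hqdef⟩ : ∃ q, q = m - 1 - p := ⟨_, rfl⟩
  have hm4 : 4 ≤ m := by omega
  have hm : m = p + q + 1 := by omega
  have hp : 1 ≤ p := by omega
  have hq : 1 ≤ q := by omega
  have hval : (((m + m : ℕ) : ℤ) ^ 2 / 2 +
      (⌊((m + m : ℕ) : ℚ) ^ 2 / 16 - ((m + m : ℕ) : ℚ) / 4 + 1 / 4⌋ - 1)) =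
      2 * (m : ℤ) ^ 2 + p * q - 1 := by
    have e1 : (((m + m : ℕ) : ℤ) ^ 2 / 2) = 2 * (m : ℤ) ^ 2 := by
      push_cast
      rw [show ((m : ℤ) + m) ^ 2 = 2 * (2 * (m : ℤ) ^ 2) by ring]
      simp
    have e2 : ⌊((m + m : ℕ) : ℚ) ^ 2 / 16 - ((m + m : ℕ) : ℚ) / 4 + 1 / 4⌋ = (p : ℤ) * q := by
      rw [Int.floor_eq_iff]
      have hqp : q = p ∨ q = p + 1 := by omega
      rw [hm]
      push_cast
      rcases hqp with h | h
      · rw [h]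
        constructor <;> nlinarith
      · rw [h]
        push_cast
        constructor <;> nlinarith
    rw [e1, e2]; ring
  rw [hval]
  let A : Fin (m + m) → Fin (m + m) → Prop := fun i j => i.1 < j.1 ∧ AdjX p i.1 j.1
  have hlow : ∀ φ : Fin (m + m) → Finset ℕ, IsDIRep A φ →
      2 * m ^ 2 + p * q ≤ (Finset.univ.biUnion φ).card + 1 := by
    intro φ hφ
    let ψ : ℕ → Finset ℕ := fun i => if h : i < m + m then φ ⟨i, h⟩ else ∅
    have hψ : ∀ i (h : i < m + m), ψ i = φ ⟨i, h⟩ := fun i h => dif_pos h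
    have key := din_lower m p q hm hp hq ψ
      (by
        intro i j hij hj hA
        rw [hψ i (by omega), hψ j (by omega)]
        exact (hφ.2 _ _).1 ⟨hij, hA⟩)
      (by
        intro i j hij hj hA
        rw [hψ i (by omega), hψ j (by omega)]
        intro hc hne
        exact hA ((hφ.2 ⟨i, by omega⟩ ⟨j, by omega⟩).2 ⟨hne, hc⟩).2)
    have : (Finset.range (2 * m)).biUnion ψ ⊆ Finset.univ.biUnion φ := by
      intro x hx
      simp only [Finset.mem_biUnion, Finset.mem_range] at hx
      obtain ⟨i, hi, hx⟩ := hx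
      rw [hψ i (by omega)] at hx
      exact Finset.mem_biUnion.2 ⟨_, Finset.mem_univ _, hx⟩
    have := Finset.card_le_card this
    omega
  refine ⟨A, ?_, ?_, ?_⟩
  · rintro ⟨k, c, hk, hc, h⟩
    have : ∀ i ≤ k, (c 0).1 + i ≤ (c i).1 := by
      intro i
      induction i with
      | zero => intro _; simp
      | succ i ih =>
        intro hi
        have h1 := ih (by omega)
        have h2 : (c i).1 < (c (i + 1)).1 := (h i (by omega)).1
        omega
    have := this k le_rfl
    rw [hc] at this
    omega
  · let e : ℕ × ℕ ↪ ℕ := Nat.pairEquiv.toEmbedding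
    let φ : Fin (m + m) → Finset ℕ := fun v => (rep m p q v.1).map e
    have hcard : ∀ v, (φ v).card = m + v.1 := by
      intro v
      rw [Finset.card_map]
      exact card_rep m p q v.1 hm hp hq hm4 (by omega)
    have hrep : IsDIRep A φ := by
      refine ⟨fun v => Finset.card_pos.1 (by rw [hcard]; omega), fun u v => ?_⟩
      rw [hcard, hcard]
      have hh : u.1 < v.1 → (AdjX p u.1 v.1 ↔ (φ u ∩ φ v).Nonempty) := by
        intro huv
        rw [rep_adj m p q u.1 v.1 hm hp hq hm4 huv (by omega), ← Finset.map_inter,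
          Finset.map_nonempty]
      constructor
      · rintro ⟨h1, h2⟩
        exact ⟨(hh h1).1 h2, by omega⟩
      · rintro ⟨h1, h2⟩
        have h3 : u.1 < v.1 := by omega
        exact ⟨h3, (hh h3).2 h1⟩
    refine ⟨φ, hrep, ?_⟩
    have h1 := hlow φ hrep
    have h2 : (Finset.univ.biUnion φ).card + 1 ≤ 2 * m ^ 2 + p * q := by
      refine le_trans ?_ (rep_total m p q hm hp hq hm4)
      have : Finset.univ.biUnion φ ⊆ ((Finset.range (2 * m)).biUnion (rep m p q)).map e := by
        intro x hx
        simp only [Finset.mem_biUnion, φ, Finset.mem_map] at hx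
        obtain ⟨v, _, a, ha, rfl⟩ := hx
        exact Finset.mem_map.2 ⟨a, Finset.mem_biUnion.2
          ⟨v.1, Finset.mem_range.2 (by omega), ha⟩, rfl⟩
      have := Finset.card_le_card this
      rw [Finset.card_map] at this
      omega
    have h3 : (Finset.univ.biUnion φ).card + 1 = 2 * m ^ 2 + p * q := le_antisymm h2 h1
    have h4 : (((Finset.univ.biUnion φ).card : ℤ)) + 1 = 2 * (m : ℤ) ^ 2 + p * q := by
      exact_mod_cast h3
    linarith
  · rintro k ⟨φ, hφ, rfl⟩
    have h1 := hlow φ hφ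
    have h4 : 2 * (m : ℤ) ^ 2 + p * q ≤ (((Finset.univ.biUnion φ).card : ℤ)) + 1 := by
      exact_mod_cast h1
    linarith
end
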